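/- Let Ω ⊆ ℝ² be open, let m, E ∈ ℝ, and let u : Ω → ℂ² be differentiable with −i(σ₁∂₁u + σ₂∂₂u) + mσ₃u = Eu on Ω. Then v := σ₁·conj(u) is differentiable and satisfies −i(σ₁∂₁v + σ₂∂₂v) + mσ₃v = −Ev on Ω. Moreover, for any ν = (ν₁,ν₂) ∈ ℝ² and any point x at which −iσ₃(σ·ν)u(x) = u(x), there also holds −iσ₃(σ·ν)v(x) = v(x). (Charge conjugation: the spectrum of the Dirac operator with infinite mass boundary conditions is symmetric with respect to zero.) -/

import Mathlib

noncomputable section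

open Real Set

/-- The first Pauli matrix `σ₁` acting on `ℂ²`. -/
def sig1 (u : ℂ × ℂ) : ℂ × ℂ := (u.2, u.1)

/-- The second Pauli matrix `σ₂` acting on `ℂ²`. -/
def sig2 (u : ℂ × ℂ) : ℂ × ℂ := (-(Complex.I * u.2), Complex.I * u.1)

/-- The third Pauli matrix `σ₃` acting on `ℂ²`. -/
def s3 (u : ℂ × ℂ) : ℂ × ℂ := (u.1, -u.2)

/-- `σ·ν` acting on `ℂ²` for `ν = (ν₁, ν₂) ∈ ℝ²`. -/
def sdot (ν₁ ν₂ : ℝ) (u : ℂ × ℂ) : ℂ × ℂ :=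
  (((ν₁ : ℂ) - Complex.I * (ν₂ : ℂ)) * u.2, ((ν₁ : ℂ) + Complex.I * (ν₂ : ℂ)) * u.1)

/-- Charge conjugation `u ↦ σ₁ · conj u` on `ℂ²`. -/
def chargeConj (u : ℂ × ℂ) : ℂ × ℂ := ((starRingEnd ℂ) u.2, (starRingEnd ℂ) u.1)

/-- Partial derivative in the first coordinate of `ℝ²`. -/
def d1 (u : ℝ × ℝ → ℂ × ℂ) (p : ℝ × ℝ) : ℂ × ℂ := fderiv ℝ u p (1, 0)

/-- Partial derivative in the second coordinate of `ℝ²`. -/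
def d2 (u : ℝ × ℝ → ℂ × ℂ) (p : ℝ × ℝ) : ℂ × ℂ := fderiv ℝ u p (0, 1)

/-- Charge conjugation as a continuous real-linear map. -/
def chargeConjCLM : ℂ × ℂ →L[ℝ] ℂ × ℂ :=
  ((Complex.conjCLE : ℂ →L[ℝ] ℂ).comp (ContinuousLinearMap.snd ℝ ℂ ℂ)).prod
    ((Complex.conjCLE : ℂ →L[ℝ] ℂ).comp (ContinuousLinearMap.fst ℝ ℂ ℂ))

theorem hasFDerivAt_chargeConj {F : Type*} [NormedAddCommGroup F] [NormedSpace ℝ F]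
    {u : F → ℂ × ℂ} {p : F} (hu : DifferentiableAt ℝ u p) :
    HasFDerivAt (fun q => chargeConj (u q)) (chargeConjCLM.comp (fderiv ℝ u p)) p :=
  chargeConjCLM.hasFDerivAt.comp p hu.hasFDerivAt

theorem d1_chargeConj {u : ℝ × ℝ → ℂ × ℂ} {p : ℝ × ℝ} (hu : DifferentiableAt ℝ u p) :
    d1 (fun q => chargeConj (u q)) p = chargeConj (d1 u p) := by
  rw [d1, (hasFDerivAt_chargeConj hu).fderiv]
  rfl

theorem d2_chargeConj {u : ℝ × ℝ → ℂ × ℂ} {p : ℝ × ℝ} (hu : DifferentiableAt ℝ u p) :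
    d2 (fun q => chargeConj (u q)) p = chargeConj (d2 u p) := by
  rw [d2, (hasFDerivAt_chargeConj hu).fderiv]
  rfl

/-- Charge conjugation negates the energy in the pointwise Dirac equation, where `a` and `b` are
the values of the two partial derivatives of the spinor. -/
theorem dirac_symbol_chargeConj {m E : ℝ} {a b w : ℂ × ℂ}
    (h : (-Complex.I) • (sig1 a + sig2 b) + (m : ℂ) • s3 w = (E : ℂ) • w) :
    (-Complex.I) • (sig1 (chargeConj a) + sig2 (chargeConj b)) + (m : ℂ) • s3 (chargeConj w) =
      (-(E : ℂ)) • chargeConj w := by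
  have h₁ := congrArg (fun z => (starRingEnd ℂ) z.1) h
  have h₂ := congrArg (fun z => (starRingEnd ℂ) z.2) h
  simp [sig1, sig2, s3] at h₁ h₂
  ext1
  · simp [sig1, sig2, s3, chargeConj]
    linear_combination -h₂
  · simp [sig1, sig2, s3, chargeConj]
    linear_combination -h₁

/-- Charge conjugation preserves the infinite mass boundary condition. -/
theorem infinite_mass_chargeConj {ν₁ ν₂ : ℝ} {w : ℂ × ℂ}
    (h : (-Complex.I) • s3 (sdot ν₁ ν₂ w) = w) :
    (-Complex.I) • s3 (sdot ν₁ ν₂ (chargeConj w)) = chargeConj w := by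
  have h₁ := congrArg (fun z => (starRingEnd ℂ) z.1) h
  have h₂ := congrArg (fun z => (starRingEnd ℂ) z.2) h
  simp [sdot, s3] at h₁ h₂
  ext1
  · simp [sdot, s3, chargeConj]
    linear_combination h₂
  · simp [sdot, s3, chargeConj]
    linear_combination h₁

theorem charge_conjugation_dirac
    (Ω : Set (ℝ × ℝ)) (hΩ : IsOpen Ω) (m E : ℝ) (u : ℝ × ℝ → ℂ × ℂ)
    (hdiff : ∀ p ∈ Ω, DifferentiableAt ℝ u p)
    (heq : ∀ p ∈ Ω,
      (-Complex.I) • (sig1 (d1 u p) + sig2 (d2 u p)) + (m : ℂ) • s3 (u p) = (E : ℂ) • u p) :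
    (∀ p ∈ Ω, DifferentiableAt ℝ (fun q => chargeConj (u q)) p) ∧
    (∀ p ∈ Ω,
      (-Complex.I) • (sig1 (d1 (fun q => chargeConj (u q)) p) +
          sig2 (d2 (fun q => chargeConj (u q)) p)) +
        (m : ℂ) • s3 (chargeConj (u p)) = (-(E : ℂ)) • chargeConj (u p)) ∧
    (∀ ν₁ ν₂ : ℝ, ∀ p : ℝ × ℝ,
      (-Complex.I) • s3 (sdot ν₁ ν₂ (u p)) = u p →
        (-Complex.I) • s3 (sdot ν₁ ν₂ (chargeConj (u p))) = chargeConj (u p)) := by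
  refine ⟨fun p hp => (hasFDerivAt_chargeConj (hdiff p hp)).differentiableAt, fun p hp => ?_,
    fun _ _ _ h => infinite_mass_chargeConj h⟩
  rw [d1_chargeConj (hdiff p hp), d2_chargeConj (hdiff p hp)]
  exact dirac_symbol_chargeConj (heq p hp)
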